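/- Let p be a probability measure on ℝ^D with finite first moment and let t ∈ (0,1). Then the Gaussian-smoothed marginal density p_t(x) = (2π(1−t)²)^{−D/2} ∫ exp(−‖x − t·y‖²/(2(1−t)²)) dp(y) is strictly positive and differentiable in x, and its score satisfies ∇_x log p_t(x) = (t·m_t^p(x) − x)/(1−t)² for every x ∈ ℝ^D, where m_t^p(x) is the posterior mean of p at (x, t). -/

import Mathlib

open MeasureTheory Real Filter Topology

/-- The Gaussian kernel `G_t(x, y) = exp(−‖x − t·y‖²/(2(1−t)²))`. -/
noncomputable def gaussKernel {D : ℕ} (t : ℝ) (x y : EuclideanSpace ℝ (Fin D)) : ℝ :=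
  Real.exp (-‖x - t • y‖ ^ 2 / (2 * (1 - t) ^ 2))

/-- The posterior mean `m_t^p(x) = (∫ y·G_t(x,y) dp(y)) / (∫ G_t(x,y) dp(y))`. -/
noncomputable def postMean {D : ℕ} (p : Measure (EuclideanSpace ℝ (Fin D))) (t : ℝ)
    (x : EuclideanSpace ℝ (Fin D)) : EuclideanSpace ℝ (Fin D) :=
  (∫ y, gaussKernel t x y ∂p)⁻¹ • ∫ y, gaussKernel t x y • y ∂p

/-- The Gaussian-smoothed marginal density
`p_t(x) = (2π(1−t)²)^{−D/2} ∫ G_t(x,y) dp(y)`. -/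
noncomputable def marginalDensity {D : ℕ} (p : Measure (EuclideanSpace ℝ (Fin D))) (t : ℝ)
    (x : EuclideanSpace ℝ (Fin D)) : ℝ :=
  (2 * Real.pi * (1 - t) ^ 2) ^ (-(D : ℝ) / 2) * ∫ y, gaussKernel t x y ∂p

section GaussianSmoothing

variable {D : ℕ} {t : ℝ} {p : Measure (EuclideanSpace ℝ (Fin D))}

lemma gaussKernel_pos (t : ℝ) (x y : EuclideanSpace ℝ (Fin D)) : 0 < gaussKernel t x y :=
  Real.exp_pos _

lemma gaussKernel_le_one (t : ℝ) (x y : EuclideanSpace ℝ (Fin D)) : gaussKernel t x y ≤ 1 := by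
  rw [gaussKernel, Real.exp_le_one_iff, neg_div]
  exact neg_nonpos.2 (by positivity)

@[fun_prop]
lemma continuous_gaussKernel (t : ℝ) (x : EuclideanSpace ℝ (Fin D)) :
    Continuous (gaussKernel t x) := by
  unfold gaussKernel
  fun_prop

lemma integrable_gaussKernel [IsFiniteMeasure p] (t : ℝ) (x : EuclideanSpace ℝ (Fin D)) :
    Integrable (gaussKernel t x) p :=
  Integrable.of_bound (continuous_gaussKernel t x).aestronglyMeasurable 1 <|
    ae_of_all _ fun y ↦ by
      rw [Real.norm_of_nonneg (gaussKernel_pos t x y).le]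
      exact gaussKernel_le_one t x y

lemma integrable_gaussKernel_smul (hp : Integrable (fun y => ‖y‖) p) (t : ℝ)
    (x : EuclideanSpace ℝ (Fin D)) : Integrable (fun y => gaussKernel t x y • y) p := by
  refine hp.mono' (by fun_prop : Continuous _).aestronglyMeasurable (ae_of_all _ fun y ↦ ?_)
  rw [norm_smul, Real.norm_of_nonneg (gaussKernel_pos t x y).le]
  exact mul_le_of_le_one_left (norm_nonneg y) (gaussKernel_le_one t x y)

lemma integral_gaussKernel_pos [IsProbabilityMeasure p] (t : ℝ) (x : EuclideanSpace ℝ (Fin D)) :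
    0 < ∫ y, gaussKernel t x y ∂p :=
  integral_exp_pos (integrable_gaussKernel t x)

lemma hasFDerivAt_gaussKernel (ht : t ≠ 1) (x y : EuclideanSpace ℝ (Fin D)) :
    HasFDerivAt (fun x => gaussKernel t x y)
      (innerSL ℝ (((1 - t) ^ 2)⁻¹ • gaussKernel t x y • (t • y - x))) x := by
  have h1t : 1 - t ≠ 0 := sub_ne_zero.2 ht.symm
  have h := (((hasFDerivAt_id x).sub_const (t • y)).norm_sq.neg.mul_const
    (2 * (1 - t) ^ 2)⁻¹).exp
  simp only [gaussKernel, div_eq_mul_inv]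
  refine h.congr_fderiv ?_
  ext v
  simp
  field_simp
  ring

lemma hasFDerivAt_integral_gaussKernel [IsFiniteMeasure p] (hp : Integrable (fun y => ‖y‖) p)
    (ht : t ≠ 1) (x : EuclideanSpace ℝ (Fin D)) :
    HasFDerivAt (fun x => ∫ y, gaussKernel t x y ∂p)
      (∫ y, innerSL ℝ (((1 - t) ^ 2)⁻¹ • gaussKernel t x y • (t • y - x)) ∂p) x := by
  refine hasFDerivAt_integral_of_dominated_of_fderiv_le
    (F' := fun x y => innerSL ℝ (((1 - t) ^ 2)⁻¹ • gaussKernel t x y • (t • y - x)))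
    (bound := fun y => ((1 - t) ^ 2)⁻¹ * (|t| * ‖y‖ + (‖x‖ + 1)))
    (Metric.ball_mem_nhds x one_pos)
    (.of_forall fun x => (continuous_gaussKernel t x).aestronglyMeasurable)
    (integrable_gaussKernel t x) (by fun_prop : Continuous _).aestronglyMeasurable
    (ae_of_all _ fun y z hz ↦ ?_)
    (((hp.const_mul _).add (integrable_const _)).const_mul _)
    (ae_of_all _ fun y z _ ↦ hasFDerivAt_gaussKernel ht z y)
  have hz' : ‖z‖ ≤ ‖x‖ + 1 := by
    have := norm_le_norm_add_norm_sub x z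
    rw [← dist_eq_norm, dist_comm] at this
    linarith [Metric.mem_ball.1 hz]
  rw [innerSL_apply_norm, norm_smul, norm_smul, Real.norm_of_nonneg (gaussKernel_pos t z y).le,
    Real.norm_of_nonneg (by positivity)]
  gcongr
  calc gaussKernel t z y * ‖t • y - z‖
      ≤ ‖t • y - z‖ := mul_le_of_le_one_left (norm_nonneg _) (gaussKernel_le_one t z y)
    _ ≤ ‖t • y‖ + ‖z‖ := norm_sub_le _ _
    _ ≤ |t| * ‖y‖ + (‖x‖ + 1) := by
      rw [norm_smul, Real.norm_eq_abs]
      gcongr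

lemma integral_gaussKernel_smul_sub [IsProbabilityMeasure p] (hp : Integrable (fun y => ‖y‖) p)
    (t : ℝ) (x : EuclideanSpace ℝ (Fin D)) :
    ∫ y, gaussKernel t x y • (t • y - x) ∂p
      = (∫ y, gaussKernel t x y ∂p) • (t • postMean p t x - x) := by
  have h0 := (integral_gaussKernel_pos (p := p) t x).ne'
  simp_rw [smul_sub, smul_comm _ t]
  rw [integral_sub ((integrable_gaussKernel_smul hp t x).fun_smul t)
    ((integrable_gaussKernel t x).smul_const x), integral_smul, integral_smul_const, postMean,
    smul_inv_smul₀ h0]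

/-- The gradient of the unnormalized marginal density. -/
lemma hasGradientAt_integral_gaussKernel [IsProbabilityMeasure p]
    (hp : Integrable (fun y => ‖y‖) p) (ht : t ≠ 1) (x : EuclideanSpace ℝ (Fin D)) :
    HasGradientAt (fun x => ∫ y, gaussKernel t x y ∂p)
      (((1 - t) ^ 2)⁻¹ • (∫ y, gaussKernel t x y ∂p) • (t • postMean p t x - x)) x := by
  have hint : Integrable (fun y => gaussKernel t x y • (t • y - x)) p := by
    simp_rw [smul_sub, smul_comm _ t]
    exact ((integrable_gaussKernel_smul hp t x).smul t).sub
      ((integrable_gaussKernel t x).smul_const x)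
  refine (hasFDerivAt_integral_gaussKernel hp ht x).congr_fderiv ?_
  rw [(innerSL ℝ).integral_comp_comm (hint.fun_smul _), integral_smul,
    integral_gaussKernel_smul_sub hp]
  rfl

end GaussianSmoothing

/-- The marginal density is positive, differentiable, and its score is
`∇_x log p_t(x) = (t·m_t^p(x) − x)/(1−t)²`. -/
theorem score_eq_postMean
    (D : ℕ) (p : Measure (EuclideanSpace ℝ (Fin D))) [IsProbabilityMeasure p]
    (hp : Integrable (fun y => ‖y‖) p)
    (t : ℝ) (ht : t ∈ Set.Ioo (0 : ℝ) 1)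
    (x : EuclideanSpace ℝ (Fin D)) :
    0 < marginalDensity p t x ∧
    DifferentiableAt ℝ (marginalDensity p t) x ∧
    gradient (fun x' => Real.log (marginalDensity p t x')) x
      = ((1 - t) ^ 2)⁻¹ • (t • postMean p t x - x) := by
  have ht1 : 0 < 1 - t := sub_pos.2 ht.2
  have hI := integral_gaussKernel_pos (p := p) t x
  have hpos : 0 < marginalDensity p t x :=
    mul_pos (Real.rpow_pos_of_pos (by positivity) _) hI
  have hI' := hasGradientAt_integral_gaussKernel hp ht.2.ne x
  have hd : HasFDerivAt (marginalDensity p t) _ x := hI'.hasFDerivAt.const_mul _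
  refine ⟨hpos, hd.differentiableAt, HasGradientAt.gradient ?_⟩
  refine (hd.log hpos.ne').congr_fderiv ?_
  ext v
  have hc : (2 * Real.pi * (1 - t) ^ 2) ^ (-(D : ℝ) / 2) ≠ 0 :=
    (Real.rpow_pos_of_pos (by positivity) _).ne'
  have hI0 := hI.ne'
  simp only [marginalDensity, smul_apply, map_smul, smul_eq_mul]
  field_simp
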